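/- For every integer m ≥ 1 there exist constants C > 0 and λ₀ > 0 such that for all real λ ≥ λ₀, the m-th moment of L satisfies |Ex[L^m] − λ^m/(m+1) − m·λ^{m−1}·(log λ)/2| ≤ C·λ^{m−1}. -/

import Mathlib

/-- `D lam l = ∑_{k=0}^{l} l! / ((l-k)! * lam^k)`. -/
noncomputable def D (lam : ℝ) (l : ℕ) : ℝ :=
  ∑ k ∈ Finset.range (l + 1),
    (Nat.factorial l : ℝ) / ((Nat.factorial (l - k) : ℝ) * lam ^ k)

theorem D_zero (lam : ℝ) : D lam 0 = 1 := by
  simp [D]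

theorem D_succ (lam : ℝ) (l : ℕ) : D lam (l + 1) = 1 + (l + 1) / lam * D lam l := by
  unfold D
  rw [Finset.sum_range_succ', Finset.mul_sum, add_comm]
  congr 1
  · have := Nat.factorial_ne_zero (l + 1)
    have h : ((l + 1).factorial : ℝ) ≠ 0 := by exact_mod_cast this
    simp [h]
  · refine Finset.sum_congr rfl fun k _ => ?_
    rw [Nat.add_sub_add_right, Nat.factorial_succ, pow_succ, div_mul_div_comm]
    push_cast
    ring

theorem one_le_D {lam : ℝ} (hlam : 0 < lam) (l : ℕ) : 1 ≤ D lam l := by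
  induction l with
  | zero => rw [D_zero]
  | succ l ih =>
    rw [D_succ]
    have : 0 ≤ ((l : ℝ) + 1) / lam * D lam l := by positivity
    linarith

/-- The probability that the first `l` servers are all busy (Erlang's loss formula). -/
noncomputable def blocking (lam : ℝ) (l : ℕ) : ℝ := 1 / D lam l

/-- The mean number of idle servers in the loss system with `l` servers. -/
noncomputable def idle (lam : ℝ) (l : ℕ) : ℝ := lam * blocking lam l - lam + l

theorem mul_blocking (lam : ℝ) (l : ℕ) : lam * blocking lam l = lam - l + idle lam l := by
  unfold idle
  ring

theorem blocking_pos {lam : ℝ} (hlam : 0 < lam) (l : ℕ) : 0 < blocking lam l :=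
  one_div_pos.2 (zero_lt_one.trans_le (one_le_D hlam l))

theorem blocking_le_one {lam : ℝ} (hlam : 0 < lam) (l : ℕ) : blocking lam l ≤ 1 :=
  (div_le_one (zero_lt_one.trans_le (one_le_D hlam l))).2 (one_le_D hlam l)

theorem blocking_zero (lam : ℝ) : blocking lam 0 = 1 := by
  simp [blocking, D_zero]

theorem idle_zero (lam : ℝ) : idle lam 0 = 0 := by
  simp [idle, blocking_zero]

theorem blocking_succ {lam : ℝ} (hlam : 0 < lam) (l : ℕ) :
    blocking lam (l + 1) * (lam * blocking lam l + (l + 1)) = lam * blocking lam l := by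
  have h := one_le_D hlam l
  have h' := one_le_D hlam (l + 1)
  have e : lam * D lam (l + 1) = lam + (l + 1) * D lam l := by
    rw [D_succ]
    field_simp
  unfold blocking
  have h0 : D lam l ≠ 0 := by positivity
  have h0' : D lam (l + 1) ≠ 0 := by positivity
  field_simp
  linarith

theorem blocking_eq_succ_mul {lam : ℝ} (hlam : 0 < lam) (l : ℕ) :
    blocking lam l = blocking lam (l + 1) * (1 + (idle lam l + 1) / lam) := by
  have h := blocking_succ hlam l
  unfold idle
  field_simp
  linarith

theorem idle_succ {lam : ℝ} (hlam : 0 < lam) (l : ℕ) :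
    idle lam (l + 1) = (idle lam l + 1) * (1 - blocking lam (l + 1)) := by
  have h := blocking_succ hlam l
  unfold idle
  push_cast
  linarith

theorem idle_nonneg {lam : ℝ} (hlam : 0 < lam) (l : ℕ) : 0 ≤ idle lam l := by
  induction l with
  | zero => rw [idle_zero]
  | succ l ih =>
    rw [idle_succ hlam]
    exact mul_nonneg (by linarith) (sub_nonneg.2 (blocking_le_one hlam _))

theorem blocking_antitone {lam : ℝ} (hlam : 0 < lam) : Antitone (blocking lam) := by
  refine antitone_nat_of_succ_le fun l => ?_
  rw [blocking_eq_succ_mul hlam l]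
  have h : 0 ≤ (idle lam l + 1) / lam := div_nonneg (by linarith [idle_nonneg hlam l]) hlam.le
  nlinarith [blocking_pos hlam (l + 1)]

theorem idle_add_one_mul_blocking_le {lam : ℝ} (hlam : 0 < lam) (l : ℕ) :
    (idle lam l + 1) * blocking lam l ≤ 1 := by
  induction l with
  | zero => simp [idle_zero, blocking_zero]
  | succ l ih =>
    have hb := blocking_antitone hlam (Nat.le_succ l)
    have h : (idle lam l + 1) * blocking lam (l + 1) ≤ 1 :=
      (mul_le_mul_of_nonneg_left hb (by linarith [idle_nonneg hlam l])).trans ih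
    rw [idle_succ hlam]
    nlinarith [blocking_le_one hlam (l + 1)]

theorem idle_mul_sub_le {lam : ℝ} (hlam : 0 < lam) (l : ℕ) :
    idle lam l * (lam - l) ≤ lam := by
  have h := idle_add_one_mul_blocking_le hlam l
  have hi := idle_nonneg hlam l
  have hb := mul_blocking lam l
  have := blocking_pos hlam l
  nlinarith [mul_nonneg hi hi]

theorem idle_le_sqrt {lam : ℝ} (hlam : 0 < lam) {l : ℕ} (hl : (l : ℝ) ≤ lam) :
    idle lam l ≤ √lam := by
  apply Real.le_sqrt_of_sq_le
  have h := idle_add_one_mul_blocking_le hlam l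
  have hi := idle_nonneg hlam l
  have hb := mul_blocking lam l
  have := blocking_pos hlam l
  nlinarith [mul_nonneg hi (sub_nonneg.2 hl)]

theorem succ_mul_blocking_succ_le {lam : ℝ} (hlam : 0 < lam) (l : ℕ) :
    (l + 1) * blocking lam (l + 1) ≤ lam * blocking lam l := by
  have h := blocking_succ hlam l
  have := mul_pos (blocking_pos hlam (l + 1)) (mul_pos hlam (blocking_pos hlam l))
  nlinarith

theorem D_add_le {lam : ℝ} (hlam : 0 < lam) (l k : ℕ) (h : (l : ℝ) + k ≤ lam) :
    D lam (l + k) ≤ D lam l + k := by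
  induction k with
  | zero => simp
  | succ k ih =>
    push_cast at h
    have ih := ih (by linarith)
    rw [← add_assoc, D_succ]
    have h1 : (((l + k : ℕ) : ℝ) + 1) / lam ≤ 1 := by
      rw [div_le_one hlam]
      push_cast
      linarith
    have := one_le_D hlam (l + k)
    push_cast at h1 ⊢
    nlinarith

theorem D_le_of_lt {lam : ℝ} (hlam : 0 < lam) {l : ℕ} (h : (l : ℝ) < lam) :
    D lam l ≤ lam / (lam - l) := by
  have hb := mul_blocking lam l
  have hi := idle_nonneg hlam l
  have hD := one_le_D hlam l
  have : D lam l * blocking lam l = 1 := by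
    unfold blocking
    field_simp
  rw [le_div_iff₀ (by linarith)]
  nlinarith [mul_nonneg hi (zero_le_one.trans hD)]

theorem D_floor_le {lam : ℝ} (hlam : 4 ≤ lam) : D lam ⌊lam⌋₊ ≤ 4 * √lam := by
  have hpos : 0 < lam := by linarith
  have hs : 2 ≤ √lam := Real.le_sqrt_of_sq_le (by linarith)
  have hsq : √lam * √lam = lam := Real.mul_self_sqrt hpos.le
  have hk := Nat.ceil_lt_add_one (Real.sqrt_nonneg lam)
  have hk' := Nat.le_ceil √lam
  have hN := Nat.floor_le hpos.le
  have hkN : ⌈√lam⌉₊ ≤ ⌊lam⌋₊ := by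
    apply Nat.le_floor
    nlinarith
  set k := ⌈√lam⌉₊
  set N := ⌊lam⌋₊
  have hcast : ((N - k : ℕ) : ℝ) = N - k := Nat.cast_sub hkN
  have h1 := D_add_le hpos (N - k) k (by rw [hcast]; linarith)
  rw [Nat.sub_add_cancel hkN] at h1
  have h2 := D_le_of_lt hpos (l := N - k) (by rw [hcast]; linarith)
  have h3 : lam / (lam - ((N - k : ℕ) : ℝ)) ≤ √lam := by
    rw [hcast, div_le_iff₀ (by linarith)]
    nlinarith
  linarith

theorem blocking_floor_le {lam : ℝ} (hlam : 4 ≤ lam) : blocking lam ⌊lam⌋₊ ≤ 2 / √lam := by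
  have hpos : 0 < lam := by linarith
  have hs : 2 ≤ √lam := Real.le_sqrt_of_sq_le (by linarith)
  have hsq : √lam * √lam = lam := Real.mul_self_sqrt hpos.le
  have hN := Nat.lt_floor_add_one lam
  have hd := idle_le_sqrt hpos (Nat.floor_le hpos.le)
  have hb := mul_blocking lam ⌊lam⌋₊
  rw [le_div_iff₀ (by linarith)]
  have : √lam * (blocking lam ⌊lam⌋₊ * √lam) ≤ √lam * 2 := by nlinarith
  exact le_of_mul_le_mul_left this (by linarith)

theorem sum_log_eq {lam : ℝ} (hlam : 0 < lam) (N : ℕ) :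
    ∑ l ∈ Finset.range N, Real.log (1 + (idle lam l + 1) / lam) = Real.log (D lam N) := by
  induction N with
  | zero => simp [D_zero]
  | succ N ih =>
    have hi : 0 ≤ (idle lam N + 1) / lam :=
      div_nonneg (by linarith [idle_nonneg hlam N]) hlam.le
    have hD := one_le_D hlam N
    have hD' := one_le_D hlam (N + 1)
    rw [Finset.sum_range_succ, ih, ← Real.log_mul (by linarith) (by linarith)]
    congr 1
    have h := blocking_eq_succ_mul hlam N
    unfold blocking at h
    field_simp at h ⊢
    linarith

theorem abs_sum_idle_sub_log_le {lam : ℝ} (hlam : 4 ≤ lam) :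
    |∑ l ∈ Finset.range ⌊lam⌋₊, idle lam l / lam - Real.log lam / 2| ≤ 8 := by
  have hpos : 0 < lam := by linarith
  have hs : 2 ≤ √lam := Real.le_sqrt_of_sq_le (by linarith)
  have hsq : √lam * √lam = lam := Real.mul_self_sqrt hpos.le
  have hN := Nat.floor_le hpos.le
  have hD := one_le_D hpos ⌊lam⌋₊
  have hlog : Real.log √lam = Real.log lam / 2 := Real.log_sqrt hpos.le
  have hlog2 : Real.log 2 ≤ 1 := by linarith [Real.log_two_lt_d9]
  have hlog4 : Real.log 4 ≤ 3 := by linarith [Real.log_le_sub_one_of_pos (x := 4) (by norm_num)]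
  have upper : Real.log (D lam ⌊lam⌋₊) ≤ 3 + Real.log lam / 2 := by
    have := Real.log_le_log (by linarith) (D_floor_le hlam)
    rw [Real.log_mul (by norm_num) (by linarith), hlog] at this
    linarith
  have lower : Real.log lam / 2 - 1 ≤ Real.log (D lam ⌊lam⌋₊) := by
    have h : √lam / 2 ≤ D lam ⌊lam⌋₊ := by
      have := blocking_floor_le hlam
      unfold blocking at this
      rw [div_le_div_iff₀ (by linarith) (by linarith)] at this
      linarith
    have := Real.log_le_log (by linarith) h
    rw [Real.log_div (by linarith) (by norm_num), hlog] at this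
    linarith
  rw [← sum_log_eq hpos] at upper lower
  have hterm : ∀ l ∈ Finset.range ⌊lam⌋₊,
      Real.log (1 + (idle lam l + 1) / lam) ≤ idle lam l / lam + 1 / lam ∧
      idle lam l / lam ≤ Real.log (1 + (idle lam l + 1) / lam) + 4 / lam := by
    intro l hl
    have hl' : (l : ℝ) ≤ lam := by
      have : (l : ℝ) ≤ ⌊lam⌋₊ := by exact_mod_cast (Finset.mem_range.1 hl).le
      linarith
    have hi := idle_nonneg hpos l
    have hi' := idle_le_sqrt hpos hl'
    have ht : 0 ≤ (idle lam l + 1) / lam := by positivity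
    have hsplit : (idle lam l + 1) / lam = idle lam l / lam + 1 / lam := add_div _ _ _
    have hinv : 0 ≤ 1 / lam := by positivity
    have ht2 : ((idle lam l + 1) / lam) ^ 2 ≤ 4 / lam := by
      rw [div_pow, div_le_div_iff₀ (by positivity) hpos]
      have : (idle lam l + 1) ^ 2 ≤ 4 * lam := by nlinarith
      nlinarith
    constructor
    · have := Real.log_le_sub_one_of_pos (x := 1 + (idle lam l + 1) / lam) (by linarith)
      linarith
    · have := Real.one_sub_inv_le_log_of_pos (x := 1 + (idle lam l + 1) / lam) (by linarith)
      have h2 : (idle lam l + 1) / lam - ((idle lam l + 1) / lam) ^ 2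
          ≤ 1 - (1 + (idle lam l + 1) / lam)⁻¹ := by
        generalize (idle lam l + 1) / lam = t at ht
        have e : 1 - (1 + t)⁻¹ - (t - t ^ 2) = t ^ 3 / (1 + t) := by
          field_simp
          ring
        have : 0 ≤ t ^ 3 / (1 + t) := by positivity
        linarith
      linarith
  have s1 := Finset.sum_le_sum fun l hl => (hterm l hl).1
  have s2 := Finset.sum_le_sum fun l hl => (hterm l hl).2
  rw [Finset.sum_add_distrib] at s1 s2
  simp only [Finset.sum_const, Finset.card_range, nsmul_eq_mul] at s1 s2
  have c1 : (⌊lam⌋₊ : ℝ) * (1 / lam) ≤ 1 := by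
    rw [mul_one_div, div_le_one hpos]
    exact hN
  have c2 : (⌊lam⌋₊ : ℝ) * (4 / lam) ≤ 4 := by
    have e : (⌊lam⌋₊ : ℝ) * (4 / lam) = 4 * (⌊lam⌋₊ * (1 / lam)) := by ring
    linarith
  rw [abs_le]
  constructor <;> linarith

theorem pow_succ_sub_pow_succ_le {a b : ℝ} (ha : 0 ≤ a) (hab : a ≤ b) (n : ℕ) :
    b ^ (n + 1) - a ^ (n + 1) ≤ (n + 1) * b ^ n * (b - a) := by
  induction n with
  | zero => simp
  | succ n ih =>
    have h1 : a ^ (n + 1) ≤ b ^ (n + 1) := pow_le_pow_left₀ ha hab _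
    have e : b ^ (n + 1 + 1) - a ^ (n + 1 + 1)
        = b * (b ^ (n + 1) - a ^ (n + 1)) + a ^ (n + 1) * (b - a) := by ring
    rw [e]
    have h2 := mul_le_mul_of_nonneg_left ih (ha.trans hab)
    have h3 := mul_le_mul_of_nonneg_right h1 (sub_nonneg.2 hab)
    push_cast
    calc _ ≤ _ := add_le_add h2 h3
      _ = _ := by ring

theorem le_pow_succ_sub_pow_succ {a b : ℝ} (ha : 0 ≤ a) (hab : a ≤ b) (n : ℕ) :
    (n + 1) * a ^ n * (b - a) ≤ b ^ (n + 1) - a ^ (n + 1) := by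
  induction n with
  | zero => simp
  | succ n ih =>
    have h1 : a ^ (n + 1) ≤ b ^ (n + 1) := pow_le_pow_left₀ ha hab _
    have e : b ^ (n + 1 + 1) - a ^ (n + 1 + 1)
        = a * (b ^ (n + 1) - a ^ (n + 1)) + b ^ (n + 1) * (b - a) := by ring
    rw [e]
    have h2 := mul_le_mul_of_nonneg_left ih ha
    have h3 := mul_le_mul_of_nonneg_right h1 (sub_nonneg.2 hab)
    push_cast
    calc _ = _ := by ring
      _ ≤ _ := add_le_add h2 h3

theorem one_add_pow_le_one_add_two_pow_mul {t : ℝ} (ht : 0 ≤ t) (ht1 : t ≤ 1) (n : ℕ) :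
    (1 + t) ^ n ≤ 1 + (2 ^ n - 1) * t := by
  induction n with
  | zero => simp
  | succ n ih =>
    have h2 : (1 : ℝ) ≤ 2 ^ n := one_le_pow₀ (by norm_num)
    calc (1 + t) ^ (n + 1) = (1 + t) ^ n * (1 + t) := pow_succ _ _
      _ ≤ (1 + (2 ^ n - 1) * t) * (1 + t) := by gcongr
      _ ≤ 1 + (2 ^ (n + 1) - 1) * t := by
        rw [pow_succ]
        nlinarith [mul_nonneg (mul_nonneg (sub_nonneg.2 h2) ht) (sub_nonneg.2 ht1)]

theorem summable_and_tsum_le_of_le_sub {f P : ℕ → ℝ} (hf : ∀ j, 0 ≤ f j) (hP : ∀ j, 0 ≤ P j)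
    (h : ∀ j, f j ≤ P j - P (j + 1)) : Summable f ∧ ∑' j, f j ≤ P 0 := by
  have hsum : ∀ n, ∑ j ∈ Finset.range n, f j ≤ P 0 := fun n =>
    calc ∑ j ∈ Finset.range n, f j ≤ ∑ j ∈ Finset.range n, (P j - P (j + 1)) :=
          Finset.sum_le_sum fun j _ => h j
      _ = P 0 - P n := Finset.sum_range_sub' P n
      _ ≤ P 0 := sub_le_self _ (hP n)
  exact ⟨summable_of_sum_range_le hf hsum, Real.tsum_le_of_sum_range_le hf hsum⟩

theorem weighted_blocking_le_sub {lam : ℝ} (hlam : 4 ≤ lam) {n : ℕ} (hn : 2 ^ (n + 1) ≤ √lam)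
    {l : ℕ} (hl : lam + √lam ≤ l + 1) :
    √lam / 2 * (((l : ℝ) + 2) ^ n * blocking lam (l + 1)) ≤
      lam * (((l : ℝ) + 2) ^ n * blocking lam l) -
        lam * (((l : ℝ) + 3) ^ n * blocking lam (l + 1)) := by
  have hpos : 0 < lam := by linarith
  have hs := Real.sqrt_nonneg lam
  have hb := blocking_pos hpos (l + 1)
  have h1 := succ_mul_blocking_succ_le hpos l
  have hv : (0 : ℝ) < ((l : ℝ) + 2) ^ n := by positivity
  have hl2 : (0 : ℝ) < (l : ℝ) + 2 := by positivity
  have h2 : lam * ((l : ℝ) + 3) ^ n ≤ ((l : ℝ) + 2) ^ n * (lam + 2 ^ n) := by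
    have e : ((l : ℝ) + 3) ^ n = ((l : ℝ) + 2) ^ n * (1 + 1 / ((l : ℝ) + 2)) ^ n := by
      rw [← mul_pow]
      congr 1
      field_simp
      ring
    have ht : 1 / ((l : ℝ) + 2) ≤ 1 := by
      rw [div_le_one hl2]
      linarith
    have h3 := one_add_pow_le_one_add_two_pow_mul (by positivity) ht n
    have h4 : lam * (1 / ((l : ℝ) + 2)) ≤ 1 := by
      rw [mul_one_div, div_le_one hl2]
      linarith
    have h5 : (1 : ℝ) ≤ 2 ^ n := one_le_pow₀ (by norm_num)
    rw [e, mul_left_comm]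
    gcongr
    calc lam * (1 + 1 / ((l : ℝ) + 2)) ^ n ≤ lam * (1 + (2 ^ n - 1) * (1 / ((l : ℝ) + 2))) := by
          gcongr
      _ = lam + (2 ^ n - 1) * (lam * (1 / ((l : ℝ) + 2))) := by ring
      _ ≤ lam + (2 ^ n - 1) * 1 := by gcongr
      _ ≤ lam + 2 ^ n := by linarith
  rw [pow_succ] at hn
  have h6 := mul_le_mul_of_nonneg_left h1 hv.le
  have h7 := mul_le_mul_of_nonneg_right h2 hb.le
  have h8 : 0 ≤ ((l : ℝ) + 2) ^ n * blocking lam (l + 1) * ((l + 1) - lam - 2 ^ n - √lam / 2) := by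
    apply mul_nonneg (by positivity)
    linarith
  linarith

theorem summable_and_tsum_tail_le {lam : ℝ} (hlam : 4 ≤ lam) {n : ℕ} (hn : 2 ^ (n + 1) ≤ √lam)
    {M : ℕ} (hM : lam + √lam ≤ M + 1) :
    Summable (fun j : ℕ => ((((M + 1 + j : ℕ) : ℝ) + 1) ^ n * blocking lam (M + 1 + j))) ∧
    ∑' j : ℕ, ((((M + 1 + j : ℕ) : ℝ) + 1) ^ n * blocking lam (M + 1 + j)) ≤
      2 * √lam * (((M : ℝ) + 2) ^ n * blocking lam M) := by
  have hpos : 0 < lam := by linarith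
  have hs : 0 < √lam := Real.sqrt_pos.2 hpos
  have hsq : √lam * √lam = lam := Real.mul_self_sqrt hpos.le
  have hb := fun l => (blocking_pos hpos l).le
  have key := summable_and_tsum_le_of_le_sub
    (f := fun j : ℕ => ((((M + 1 + j : ℕ) : ℝ) + 1) ^ n * blocking lam (M + 1 + j)))
    (P := fun j : ℕ => 2 * √lam * ((((M + j : ℕ) : ℝ) + 2) ^ n * blocking lam (M + j)))
    (fun j => mul_nonneg (by positivity) (hb _))
    (fun j => mul_nonneg (by positivity) (mul_nonneg (by positivity) (hb _)))
    (fun j => ?_)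
  · simpa using key
  · have h := weighted_blocking_le_sub hlam hn (l := M + j) (by push_cast; linarith)
    have e1 : M + 1 + j = M + j + 1 := by ring
    have e2 : M + (j + 1) = M + j + 1 := by ring
    have e3 : (((M + j + 1 : ℕ) : ℝ) + 1) = ((M + j : ℕ) : ℝ) + 2 := by push_cast; ring
    have e4 : (((M + j + 1 : ℕ) : ℝ) + 2) = ((M + j : ℕ) : ℝ) + 3 := by push_cast; ring
    simp only [e1, e2, e3, e4]
    have hl : ∀ x : ℝ, lam * x = √lam / 2 * (2 * √lam * x) := fun x => by
      rw [← hsq]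
      simp only [Real.sqrt_mul_self hs.le]
      ring
    rw [hl, hl, ← mul_sub] at h
    exact le_of_mul_le_mul_left h (by positivity)

theorem abs_sum_mul_sub_sub_le {lam : ℝ} (hlam : 0 < lam) (n : ℕ) :
    |∑ l ∈ Finset.range ⌊lam⌋₊, (((l : ℝ) + 1) ^ (n + 1) - (l : ℝ) ^ (n + 1)) * (lam - l)
      - lam ^ (n + 2) / (n + 2)| ≤ 2 * lam ^ (n + 1) := by
  have parts : ∀ N : ℕ,
      ∑ l ∈ Finset.range N, (((l : ℝ) + 1) ^ (n + 1) - (l : ℝ) ^ (n + 1)) * (lam - l) =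
        (N : ℝ) ^ (n + 1) * (lam - N) + ∑ l ∈ Finset.range N, ((l : ℝ) + 1) ^ (n + 1) := by
    intro N
    induction N with
    | zero => simp
    | succ N ih =>
      rw [Finset.sum_range_succ, Finset.sum_range_succ, ih]
      push_cast
      ring
  have lower : ∀ N : ℕ,
      (N : ℝ) ^ (n + 2) ≤ (n + 2) * ∑ l ∈ Finset.range N, ((l : ℝ) + 1) ^ (n + 1) := by
    intro N
    induction N with
    | zero => simp
    | succ N ih =>
      rw [Finset.sum_range_succ, mul_add]
      have h := pow_succ_sub_pow_succ_le (a := (N : ℝ)) (b := N + 1) (by positivity)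
        (by linarith) (n + 1)
      push_cast at h ⊢
      linarith
  have upper : ∀ N : ℕ, (n + 2) * ∑ l ∈ Finset.range N, ((l : ℝ) + 1) ^ (n + 1) ≤
      (N : ℝ) ^ (n + 2) + (n + 2) * (N : ℝ) ^ (n + 1) := by
    intro N
    induction N with
    | zero => simp
    | succ N ih =>
      rw [Finset.sum_range_succ, mul_add]
      have h := le_pow_succ_sub_pow_succ (a := (N : ℝ)) (b := N + 1) (by positivity)
        (by linarith) (n + 1)
      push_cast at h ⊢
      linarith
  rw [parts]
  have hN := Nat.floor_le hlam.le
  have hN' := Nat.lt_floor_add_one lam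
  have hl := lower ⌊lam⌋₊
  have hu := upper ⌊lam⌋₊
  set S := ∑ l ∈ Finset.range ⌊lam⌋₊, ((l : ℝ) + 1) ^ (n + 1)
  have hp : (⌊lam⌋₊ : ℝ) ^ (n + 1) ≤ lam ^ (n + 1) := pow_le_pow_left₀ (by positivity) hN _
  have hp2 : (⌊lam⌋₊ : ℝ) ^ (n + 2) ≤ lam ^ (n + 2) := pow_le_pow_left₀ (by positivity) hN _
  have hd := pow_succ_sub_pow_succ_le (by positivity) hN (n + 1)
  have hpos : 0 < lam ^ (n + 1) := by positivity
  have hn : (0 : ℝ) < n + 2 := by positivity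
  have hd' : lam ^ (n + 2) ≤ (⌊lam⌋₊ : ℝ) ^ (n + 2) + (n + 2) * lam ^ (n + 1) := by
    have : ((n : ℝ) + 2) * lam ^ (n + 1) * (lam - ⌊lam⌋₊) ≤ (n + 2) * lam ^ (n + 1) * 1 := by
      gcongr
      linarith
    push_cast at hd
    linarith
  have h1 : S ≤ lam ^ (n + 2) / (n + 2) + lam ^ (n + 1) := by
    rw [div_add' _ _ _ hn.ne', le_div_iff₀ hn]
    nlinarith
  have h2 : lam ^ (n + 2) / (n + 2) ≤ S + lam ^ (n + 1) := by
    rw [div_le_iff₀ hn]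
    nlinarith
  have h3 : 0 ≤ (⌊lam⌋₊ : ℝ) ^ (n + 1) * (lam - ⌊lam⌋₊) :=
    mul_nonneg (by positivity) (by linarith)
  have h4 : (⌊lam⌋₊ : ℝ) ^ (n + 1) * (lam - ⌊lam⌋₊) ≤ lam ^ (n + 1) * 1 := by
    gcongr
    linarith
  rw [abs_le]
  constructor <;> linarith

theorem mul_pow_sub_pow_le {a b : ℝ} (ha : 0 ≤ a) (hab : a ≤ b) (n : ℕ) :
    b * (b ^ n - a ^ n) ≤ n * b ^ n * (b - a) := by
  cases n with
  | zero => simp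
  | succ n =>
    have h := mul_le_mul_of_nonneg_left (pow_succ_sub_pow_succ_le ha hab n) (ha.trans hab)
    push_cast
    calc _ ≤ _ := h
      _ = _ := by ring

theorem abs_sum_weighted_idle_sub_le {lam : ℝ} (hlam : 0 < lam) (n : ℕ) :
    |∑ l ∈ Finset.range ⌊lam⌋₊,
        (((l : ℝ) + 1) ^ (n + 1) - (l : ℝ) ^ (n + 1)) * (idle lam l / lam)
      - (n + 1) * lam ^ n * ∑ l ∈ Finset.range ⌊lam⌋₊, idle lam l / lam| ≤
      (n + 1) * n * lam ^ n := by
  rw [Finset.mul_sum, ← Finset.sum_sub_distrib]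
  have hN := Nat.floor_le hlam.le
  have hterm : ∀ l ∈ Finset.range ⌊lam⌋₊,
      |(((l : ℝ) + 1) ^ (n + 1) - (l : ℝ) ^ (n + 1)) * (idle lam l / lam)
        - (n + 1) * lam ^ n * (idle lam l / lam)| ≤ (n + 1) * n * lam ^ n * (1 / lam) := by
    intro l hl
    have hl1 : (l : ℝ) + 1 ≤ lam := by
      have : (l : ℝ) + 1 ≤ ⌊lam⌋₊ := by exact_mod_cast Finset.mem_range.1 hl
      linarith
    have hi := idle_nonneg hlam l
    have hq : 0 ≤ idle lam l / lam := by positivity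
    have hw1 := le_pow_succ_sub_pow_succ (a := (l : ℝ)) (b := l + 1) (by positivity)
      (by linarith) n
    have hw2 := pow_succ_sub_pow_succ_le (a := (l : ℝ)) (b := l + 1) (by positivity)
      (by linarith) n
    have hpow : ((l : ℝ) + 1) ^ n ≤ lam ^ n := pow_le_pow_left₀ (by positivity) hl1 _
    have hn : (0 : ℝ) < n + 1 := by positivity
    have hwle : ((l : ℝ) + 1) ^ (n + 1) - (l : ℝ) ^ (n + 1) ≤ (n + 1) * lam ^ n := by nlinarith
    rw [← sub_mul, abs_mul, abs_of_nonneg hq, abs_of_nonpos (by linarith)]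
    calc -(((l : ℝ) + 1) ^ (n + 1) - (l : ℝ) ^ (n + 1) - (n + 1) * lam ^ n) * (idle lam l / lam)
        ≤ ((n + 1) * (lam ^ n - (l : ℝ) ^ n)) * (idle lam l / lam) := by
          gcongr
          linarith
      _ = (n + 1) * (lam * (lam ^ n - (l : ℝ) ^ n)) * idle lam l / lam ^ 2 := by
          field_simp
      _ ≤ (n + 1) * (n * lam ^ n * (lam - l)) * idle lam l / lam ^ 2 := by
          gcongr ((n : ℝ) + 1) * ?_ * idle lam l / lam ^ 2
          exact mul_pow_sub_pow_le (a := (l : ℝ)) (b := lam) (by positivity) (by linarith) n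
      _ = (n + 1) * n * lam ^ n * (idle lam l * (lam - l)) / lam ^ 2 := by ring
      _ ≤ (n + 1) * n * lam ^ n * lam / lam ^ 2 := by
          gcongr
          exact idle_mul_sub_le hlam l
      _ = (n + 1) * n * lam ^ n * (1 / lam) := by
          field_simp
  refine (Finset.abs_sum_le_sum_abs _ _).trans ((Finset.sum_le_sum hterm).trans ?_)
  rw [Finset.sum_const, Finset.card_range, nsmul_eq_mul, mul_left_comm]
  apply mul_le_of_le_one_right (by positivity)
  rw [mul_one_div, div_le_one hlam]
  exact hN

theorem abs_sum_range_floor_sub_le {lam : ℝ} (hlam : 4 ≤ lam) (n : ℕ) :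
    |∑ l ∈ Finset.range ⌊lam⌋₊,
        (((l : ℝ) + 1) ^ (n + 1) - (l : ℝ) ^ (n + 1)) * blocking lam l
      - lam ^ (n + 1) / (n + 2) - (n + 1) * lam ^ n * (Real.log lam / 2)| ≤
      (2 + (n + 1) * n + 8 * (n + 1)) * lam ^ n := by
  have hpos : 0 < lam := by linarith
  have h1 := abs_sum_mul_sub_sub_le hpos n
  have h2 := abs_sum_weighted_idle_sub_le hpos n
  have h3 := mul_le_mul_of_nonneg_left (abs_sum_idle_sub_log_le hlam)
    (show 0 ≤ (n + 1) * lam ^ n by positivity)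
  rw [← abs_of_nonneg (show 0 ≤ (n + 1) * lam ^ n by positivity), ← abs_mul,
    abs_of_nonneg (show 0 ≤ (n + 1) * lam ^ n by positivity)] at h3
  have h1' : |(∑ l ∈ Finset.range ⌊lam⌋₊,
      (((l : ℝ) + 1) ^ (n + 1) - (l : ℝ) ^ (n + 1)) * (lam - l)) / lam
      - lam ^ (n + 1) / (n + 2)| ≤ 2 * lam ^ n := by
    have e : ∀ x : ℝ, x / lam - lam ^ (n + 1) / (n + 2) = (x - lam ^ (n + 2) / (n + 2)) / lam :=
      fun x => by
        rw [sub_div]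
        congr 1
        field_simp
        ring
    rw [e, abs_div, abs_of_pos hpos, div_le_iff₀ hpos]
    calc _ ≤ _ := h1
      _ = _ := by ring
  have split : ∑ l ∈ Finset.range ⌊lam⌋₊,
        (((l : ℝ) + 1) ^ (n + 1) - (l : ℝ) ^ (n + 1)) * blocking lam l =
      (∑ l ∈ Finset.range ⌊lam⌋₊,
        (((l : ℝ) + 1) ^ (n + 1) - (l : ℝ) ^ (n + 1)) * (lam - l)) / lam +
      ∑ l ∈ Finset.range ⌊lam⌋₊,
        (((l : ℝ) + 1) ^ (n + 1) - (l : ℝ) ^ (n + 1)) * (idle lam l / lam) := by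
    rw [Finset.sum_div, ← Finset.sum_add_distrib]
    refine Finset.sum_congr rfl fun l _ => ?_
    have hb := mul_blocking lam l
    have hb' : blocking lam l = (lam - l) / lam + idle lam l / lam := by
      field_simp
      linarith
    rw [hb']
    ring
  rw [split]
  rw [abs_le] at h1' h2 h3 ⊢
  constructor <;> linarith [h1'.1, h1'.2, h2.1, h2.2, h3.1, h3.2]

theorem weight_le (n l : ℕ) :
    ((l : ℝ) + 1) ^ (n + 1) - (l : ℝ) ^ (n + 1) ≤ (n + 1) * ((l : ℝ) + 1) ^ n := by
  have h := pow_succ_sub_pow_succ_le (a := (l : ℝ)) (b := l + 1) (by positivity) (by linarith) n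
  simpa using h

theorem weight_nonneg (n l : ℕ) : 0 ≤ ((l : ℝ) + 1) ^ (n + 1) - (l : ℝ) ^ (n + 1) :=
  sub_nonneg.2 (pow_le_pow_left₀ (by positivity) (by linarith) _)

theorem sum_Ico_floor_le {lam : ℝ} (hlam : 4 ≤ lam) (n : ℕ) :
    ∑ l ∈ Finset.Ico ⌊lam⌋₊ (⌊lam⌋₊ + ⌈√lam⌉₊ + 1),
      (((l : ℝ) + 1) ^ (n + 1) - (l : ℝ) ^ (n + 1)) * blocking lam l ≤
      4 * (n + 1) * 4 ^ n * lam ^ n := by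
  have hpos : 0 < lam := by linarith
  have hs : 2 ≤ √lam := Real.le_sqrt_of_sq_le (by linarith)
  have hsq : √lam * √lam = lam := Real.mul_self_sqrt hpos.le
  have hk := Nat.ceil_lt_add_one (Real.sqrt_nonneg lam)
  have hN := Nat.floor_le hpos.le
  have hterm : ∀ l ∈ Finset.Ico ⌊lam⌋₊ (⌊lam⌋₊ + ⌈√lam⌉₊ + 1),
      (((l : ℝ) + 1) ^ (n + 1) - (l : ℝ) ^ (n + 1)) * blocking lam l ≤
        (n + 1) * (4 * lam) ^ n * (2 / √lam) := by
    intro l hl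
    rw [Finset.mem_Ico] at hl
    have hl1 : (l : ℝ) + 1 ≤ 4 * lam := by
      have : (l : ℝ) ≤ ⌊lam⌋₊ + ⌈√lam⌉₊ := by exact_mod_cast Nat.lt_succ_iff.1 hl.2
      nlinarith
    have hb := (blocking_antitone hpos hl.1).trans (blocking_floor_le hlam)
    exact mul_le_mul ((weight_le n l).trans (by gcongr)) hb (blocking_pos hpos l).le
      (by positivity)
  refine (Finset.sum_le_sum hterm).trans ?_
  rw [Finset.sum_const, Nat.card_Ico, nsmul_eq_mul, add_assoc, Nat.add_sub_cancel_left]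
  have hcard : ((⌈√lam⌉₊ + 1 : ℕ) : ℝ) ≤ 2 * √lam := by
    push_cast
    linarith
  calc ((⌈√lam⌉₊ + 1 : ℕ) : ℝ) * ((n + 1) * (4 * lam) ^ n * (2 / √lam))
      ≤ 2 * √lam * ((n + 1) * (4 * lam) ^ n * (2 / √lam)) := by gcongr
    _ = 4 * (n + 1) * 4 ^ n * lam ^ n := by
      rw [mul_pow]
      field_simp
      ring

theorem summable_and_tsum_weighted_tail_le {lam : ℝ} (hlam : 4 ≤ lam) {n : ℕ}
    (hn : 2 ^ (n + 1) ≤ √lam) {M : ℕ} (hM : M = ⌊lam⌋₊ + ⌈√lam⌉₊) :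
    Summable (fun j : ℕ => (((j + (M + 1) : ℕ) + 1 : ℝ) ^ (n + 1) -
      ((j + (M + 1) : ℕ) : ℝ) ^ (n + 1)) * blocking lam (j + (M + 1))) ∧
    ∑' j : ℕ, (((j + (M + 1) : ℕ) + 1 : ℝ) ^ (n + 1) -
      ((j + (M + 1) : ℕ) : ℝ) ^ (n + 1)) * blocking lam (j + (M + 1)) ≤
      4 * (n + 1) * 4 ^ n * lam ^ n := by
  have hpos : 0 < lam := by linarith
  have hs : 2 ≤ √lam := Real.le_sqrt_of_sq_le (by linarith)
  have hsq : √lam * √lam = lam := Real.mul_self_sqrt hpos.le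
  have hk := Nat.ceil_lt_add_one (Real.sqrt_nonneg lam)
  have hk' := Nat.le_ceil √lam
  have hN := Nat.floor_le hpos.le
  have hN' := Nat.lt_floor_add_one lam
  have hMc : (M : ℝ) = ⌊lam⌋₊ + ⌈√lam⌉₊ := by
    rw [hM]
    push_cast
    ring
  obtain ⟨hsum, hle⟩ := summable_and_tsum_tail_le hlam hn (M := M) (by linarith)
  simp only [add_comm (M + 1)] at hsum hle
  have hterm : ∀ j : ℕ, (((j + (M + 1) : ℕ) + 1 : ℝ) ^ (n + 1) -
      ((j + (M + 1) : ℕ) : ℝ) ^ (n + 1)) * blocking lam (j + (M + 1)) ≤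
      (n + 1) * ((((j + (M + 1) : ℕ) : ℝ) + 1) ^ n * blocking lam (j + (M + 1))) := fun j => by
    rw [← mul_assoc]
    exact mul_le_mul_of_nonneg_right (weight_le n _) (blocking_pos hpos _).le
  have hsum' := hsum.mul_left ((n : ℝ) + 1)
  have hS := Summable.of_nonneg_of_le
    (fun j => mul_nonneg (weight_nonneg n (j + (M + 1))) (blocking_pos hpos _).le) hterm hsum'
  refine ⟨hS, (hS.tsum_le_tsum hterm hsum').trans ?_⟩
  rw [tsum_mul_left]
  have hb := (blocking_antitone hpos (show ⌊lam⌋₊ ≤ M by omega)).trans (blocking_floor_le hlam)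
  have hM2 : (M : ℝ) + 2 ≤ 4 * lam := by nlinarith
  calc _ ≤ ((n : ℝ) + 1) * (2 * √lam * (((M : ℝ) + 2) ^ n * blocking lam M)) := by gcongr
    _ ≤ ((n : ℝ) + 1) * (2 * √lam * ((4 * lam) ^ n * (2 / √lam))) := by
      gcongr
      exact (blocking_pos hpos M).le
    _ = 4 * (n + 1) * 4 ^ n * lam ^ n := by
      rw [mul_pow]
      field_simp
      ring

/-- For every integer `m ≥ 1` there are constants `C > 0`, `λ₀ > 0` such that for all
`λ ≥ λ₀`, `|Ex[L^m] − λ^m/(m+1) − m·λ^{m−1}·(log λ)/2| ≤ C·λ^{m−1}`, where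
`Ex[L^m] = ∑_{l=0}^∞ ((l+1)^m − l^m)/D_λ(l)`. -/
theorem moments_asymptotics (m : ℕ) (hm : 1 ≤ m) :
    ∃ C > (0 : ℝ), ∃ lam₀ > (0 : ℝ), ∀ lam : ℝ, lam₀ ≤ lam →
      |(∑' l : ℕ, (((l : ℝ) + 1) ^ m - (l : ℝ) ^ m) / D lam l)
          - lam ^ m / (m + 1) - m * lam ^ (m - 1) * Real.log lam / 2|
        ≤ C * lam ^ (m - 1) := by
  obtain ⟨n, rfl⟩ := Nat.exists_eq_add_of_le' hm
  refine ⟨(2 + (n + 1) * n + 8 * (n + 1)) + 8 * (n + 1) * 4 ^ n, by positivity,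
    4 ^ (n + 1), by positivity, fun lam hlam => ?_⟩
  have hlam4 : 4 ≤ lam := le_trans (le_self_pow₀ (by norm_num) (by omega)) hlam
  have hpos : 0 < lam := by linarith
  have hn : 2 ^ (n + 1) ≤ √lam := by
    apply Real.le_sqrt_of_sq_le
    rw [← pow_mul, mul_comm, pow_mul]
    norm_num
    exact hlam
  have head := abs_sum_range_floor_sub_le hlam4 n
  have mid := sum_Ico_floor_le hlam4 n
  obtain ⟨hsum, tail⟩ := summable_and_tsum_weighted_tail_le hlam4 hn rfl
  set M := ⌊lam⌋₊ + ⌈√lam⌉₊ with hM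
  set f : ℕ → ℝ := fun l => (((l : ℝ) + 1) ^ (n + 1) - (l : ℝ) ^ (n + 1)) * blocking lam l
    with hf
  have hf0 : ∀ l, 0 ≤ f l := fun l => mul_nonneg (weight_nonneg n l) (blocking_pos hpos l).le
  have hterm : ∀ l : ℕ, (((l : ℝ) + 1) ^ (n + 1) - (l : ℝ) ^ (n + 1)) / D lam l = f l :=
    fun l => (mul_one_div _ _).symm
  have hsumf : Summable f := (summable_nat_add_iff (M + 1)).1 hsum
  have split := hsumf.sum_add_tsum_nat_add (M + 1)
  rw [← Finset.sum_range_add_sum_Ico f (show ⌊lam⌋₊ ≤ M + 1 by omega)] at split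
  have mid0 : 0 ≤ ∑ l ∈ Finset.Ico ⌊lam⌋₊ (M + 1), f l := Finset.sum_nonneg fun l _ => hf0 l
  have tail0 : 0 ≤ ∑' j, f (j + (M + 1)) := tsum_nonneg fun j => hf0 _
  change ∑ l ∈ Finset.Ico ⌊lam⌋₊ (M + 1), f l ≤ _ at mid
  change ∑' j, f (j + (M + 1)) ≤ _ at tail
  simp only [hterm, Nat.add_sub_cancel]
  rw [← split]
  push_cast
  have e : (n : ℝ) + 1 + 1 = n + 2 := by ring
  rw [e]
  rw [abs_le] at head ⊢
  constructor <;> linarith [head.1, head.2]
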